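/- Let N ≥ 7 and (N+1)/2 ≤ m < N−1 be integers. Then for any constant 0 < σ < N−2 there exists a constant C > 0 such that for all ξ ∈ ℝ^{N−m} and all x = (y,z) ∈ ℝ^m × ℝ^{N−m}: ∫_{ℝ^N} |x−x̃|^{−(N−2)} |ỹ|^{−1}(1+|ỹ|+|z̃−ξ|)^{−(1+σ)} dx̃ ≤ C(1+|y|+|z−ξ|)^{−σ}, where x̃ = (ỹ,z̃) ∈ ℝ^m × ℝ^{N−m}. -/

import Mathlib

noncomputable section

open MeasureTheory Real Filter Asymptotics Metric

/-- Euclidean space `ℝ^n`. -/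
abbrev Euc (n : ℕ) : Type := EuclideanSpace ℝ (Fin n)

/-- Combine a vector in `ℝ^m` with a vector in `ℝ^p` into a vector in `ℝ^{m+p}`. -/
def epair {m p : ℕ} (y : Euc m) (z : Euc p) : Euc (m + p) :=
  (EuclideanSpace.equiv (Fin (m + p)) ℝ).symm
    (Fin.addCases (motive := fun _ => ℝ) (fun i => y i) (fun j => z j))

/-- First block of coordinates. -/
def yPart {m p : ℕ} (x : Euc (m + p)) : Euc m :=
  (EuclideanSpace.equiv (Fin m) ℝ).symm (fun i => x (Fin.castAdd p i))

/-- Second block of coordinates. -/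
def zPart {m p : ℕ} (x : Euc (m + p)) : Euc p :=
  (EuclideanSpace.equiv (Fin p) ℝ).symm (fun j => x (Fin.natAdd m j))

/-- Update one coordinate of a Euclidean vector. -/
def updE {n : ℕ} (x : Euc n) (i : Fin n) (t : ℝ) : Euc n :=
  (EuclideanSpace.equiv (Fin n) ℝ).symm (Function.update (fun j => x j) i t)

/-- The Laplacian, as the sum of the pure second partial derivatives. -/
def lap {n : ℕ} (f : Euc n → ℝ) (x : Euc n) : ℝ :=
  ∑ i : Fin n, iteratedDeriv 2 (fun t => f (updE x i t)) (x i)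

/-- The Laplacian in the first block of variables. -/
def lapY {a b : ℕ} (f : Euc (a + b) → ℝ) (x : Euc (a + b)) : ℝ :=
  ∑ i : Fin a, iteratedDeriv 2 (fun t => f (epair (updE (yPart x) i t) (zPart x))) (yPart x i)

/-- The Laplacian in the second block of variables. -/
def lapZ {a b : ℕ} (f : Euc (a + b) → ℝ) (x : Euc (a + b)) : ℝ :=
  ∑ i : Fin b, iteratedDeriv 2 (fun t => f (epair (yPart x) (updE (zPart x) i t))) (zPart x i)

/-- The critical exponent `2⋆ = 2(N-1)/(N-2)`. -/
def twoStar (N : ℕ) : ℝ := 2 * ((N : ℝ) - 1) / ((N : ℝ) - 2)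

/-- The standard bubble `U_{ξ,λ}`. -/
def Ubub (m p : ℕ) (ξ : Euc p) (lam : ℝ) (x : Euc (m + p)) : ℝ :=
  (((m + p : ℕ) : ℝ) - 2) ^ (((((m + p : ℕ) : ℝ)) - 2) / 2) * ((m : ℝ) - 1) ^ ((((m + p : ℕ) : ℝ) - 2) / 2) *
    (lam / ((1 + lam * ‖yPart x‖) ^ 2 + lam ^ 2 * ‖zPart x - ξ‖ ^ 2)) ^ ((((m + p : ℕ) : ℝ) - 2) / 2)

/-- A vector in `ℝ³`. -/
def mk3 (a b c : ℝ) : Euc 3 :=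
  (EuclideanSpace.equiv (Fin 3) ℝ).symm ![a, b, c]

/-- `z'`, the first three coordinates of `z ∈ ℝ^{3+q}`. -/
def zPrime {q : ℕ} (z : Euc (3 + q)) : Euc 3 := yPart z

/-- `z''`, the remaining coordinates of `z ∈ ℝ^{3+q}`. -/
def zSecond {q : ℕ} (z : Euc (3 + q)) : Euc q := zPart z

/-- The concentration points `ξ_j^±` (the sign is `sgn`). -/
def xiPt (q k : ℕ) (r h sgn : ℝ) (w : Euc q) (j : ℕ) : Euc (3 + q) :=
  epair (mk3 (r * Real.sqrt (1 - h ^ 2) * Real.cos (2 * ((j : ℝ) - 1) * π / k))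
             (r * Real.sqrt (1 - h ^ 2) * Real.sin (2 * ((j : ℝ) - 1) * π / k))
             (sgn * (r * h))) w

/-- `|(|y|, |z'|, z'') - (0, r₀, z₀'')|`. -/
def profDist (m q : ℕ) (r0 : ℝ) (z0 : Euc q) (x : Euc (m + (3 + q))) : ℝ :=
  Real.sqrt (‖yPart x‖ ^ 2 + (‖zPrime (zPart x)‖ - r0) ^ 2 + ‖zSecond (zPart x) - z0‖ ^ 2)

/-- Distance between `(r, z'')` and `(r₀, z₀'')`. -/
def distRZ (q : ℕ) (r : ℝ) (w : Euc q) (r0 : ℝ) (w0 : Euc q) : ℝ :=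
  Real.sqrt ((r - r0) ^ 2 + ‖w - w0‖ ^ 2)

/-- The potential on `ℝ^N` induced by a function of `(r, z'')`. -/
def potX (m q : ℕ) (Vb : ℝ × Euc q → ℝ) (x : Euc (m + (3 + q))) : ℝ :=
  Vb (‖zPrime (zPart x)‖, zSecond (zPart x))

/-- The cut-off function `η`. -/
structure IsCutoff (m q : ℕ) (r0 : ℝ) (z0 : Euc q) (δ : ℝ) (η : Euc (m + (3 + q)) → ℝ) : Prop where
  smooth : ContDiff ℝ (⊤ : ℕ∞) η
  nonneg : ∀ x, 0 ≤ η x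
  le_one : ∀ x, η x ≤ 1
  eq_one : ∀ x, profDist m q r0 z0 x ≤ δ → η x = 1
  eq_zero : ∀ x, 2 * δ ≤ profDist m q r0 z0 x → η x = 0
  symm : ∀ x x', ‖yPart x‖ = ‖yPart x'‖ → ‖zPrime (zPart x)‖ = ‖zPrime (zPart x')‖ →
    zSecond (zPart x) = zSecond (zPart x') → η x = η x'

/-- `Z_{ξ_j^±,λ} = η U_{ξ_j^±,λ}`. -/
def Zxi (m q k : ℕ) (η : Euc (m + (3 + q)) → ℝ) (r h sgn : ℝ) (w : Euc q) (j : ℕ)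
    (lam : ℝ) (x : Euc (m + (3 + q))) : ℝ :=
  η x * Ubub m (3 + q) (xiPt q k r h sgn w j) lam x

/-- The approximate solution `Z_{r̄,h̄,z̄'',λ}`. -/
def Zfun (m q k : ℕ) (η : Euc (m + (3 + q)) → ℝ) (r h : ℝ) (w : Euc q) (lam : ℝ)
    (x : Euc (m + (3 + q))) : ℝ :=
  ∑ j ∈ Finset.Icc 1 k, (Zxi m q k η r h 1 w j lam x + Zxi m q k η r h (-1) w j lam x)

/-- `Z^*_{r̄,h̄,z̄'',λ}` (without the cut-off). -/
def Zstar (m q k : ℕ) (r h : ℝ) (w : Euc q) (lam : ℝ) (x : Euc (m + (3 + q))) : ℝ :=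
  ∑ j ∈ Finset.Icc 1 k,
    (Ubub m (3 + q) (xiPt q k r h 1 w j) lam x + Ubub m (3 + q) (xiPt q k r h (-1) w j) lam x)

/-- The derivatives `Z_{j,l}^±` of `Z_{ξ_j^±,λ}` with respect to `λ` (`l = 2`), `r̄` (`l = 3`)
and `z̄''_l` (`l = 4, …, N-m`). -/
def Zder (m q k : ℕ) (η : Euc (m + (3 + q)) → ℝ) (r h sgn : ℝ) (w : Euc q) (j : ℕ)
    (lam : ℝ) (l : ℕ) (x : Euc (m + (3 + q))) : ℝ :=
  if l = 2 then deriv (fun t => Zxi m q k η r h sgn w j t x) lam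
  else if l = 3 then deriv (fun t => Zxi m q k η t h sgn w j lam x) r
  else if hl : l - 4 < q then
    deriv (fun t => Zxi m q k η r h sgn (updE w ⟨l - 4, hl⟩ t) j lam x) (w ⟨l - 4, hl⟩)
  else 0

/-- The weight appearing in the `‖·‖_*` norm. -/
def wgt1 (m q k : ℕ) (r h : ℝ) (w : Euc q) (lam e : ℝ) (x : Euc (m + (3 + q))) : ℝ :=
  ∑ j ∈ Finset.Icc 1 k,
    ((1 + lam * ‖yPart x‖ + lam * ‖zPart x - xiPt q k r h 1 w j‖) ^ (-e) +
     (1 + lam * ‖yPart x‖ + lam * ‖zPart x - xiPt q k r h (-1) w j‖) ^ (-e))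

/-- The weight appearing in the `‖·‖_{**}` norm. -/
def wgt2 (m q k : ℕ) (r h : ℝ) (w : Euc q) (lam e : ℝ) (x : Euc (m + (3 + q))) : ℝ :=
  ∑ j ∈ Finset.Icc 1 k,
    (1 / (lam * ‖yPart x‖) * (1 + lam * ‖yPart x‖ + lam * ‖zPart x - xiPt q k r h 1 w j‖) ^ (-e) +
     1 / (lam * ‖yPart x‖) * (1 + lam * ‖yPart x‖ + lam * ‖zPart x - xiPt q k r h (-1) w j‖) ^ (-e))

/-- The `‖·‖_*` norm. -/
def starNorm (m q k : ℕ) (r h : ℝ) (w : Euc q) (lam τ : ℝ) (u : Euc (m + (3 + q)) → ℝ) : ℝ :=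
  ⨆ x : Euc (m + (3 + q)),
    lam ^ (-((((m + (3 + q) : ℕ) : ℝ) - 2) / 2)) * |u x| /
      wgt1 m q k r h w lam (((((m + (3 + q) : ℕ) : ℝ)) - 2) / 2 + τ) x

/-- The `‖·‖_{**}` norm. -/
def dstarNorm (m q k : ℕ) (r h : ℝ) (w : Euc q) (lam τ : ℝ) (f : Euc (m + (3 + q)) → ℝ) : ℝ :=
  ⨆ x : Euc (m + (3 + q)),
    lam ^ (-((((m + (3 + q) : ℕ) : ℝ) + 2) / 2)) * |f x| /
      wgt2 m q k r h w lam ((((m + (3 + q) : ℕ) : ℝ)) / 2 + τ) x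

/-- Rotation by angle `θ` in the `(z₁,z₂)`-plane. -/
def rot2 {q : ℕ} (θ : ℝ) (z : Euc (3 + q)) : Euc (3 + q) :=
  epair (mk3 (Real.cos θ * zPrime z 0 - Real.sin θ * zPrime z 1)
             (Real.sin θ * zPrime z 0 + Real.cos θ * zPrime z 1)
             (zPrime z 2)) (zSecond z)

/-- The reflection `(z₁,z₂,z₃) ↦ (z₁,-z₂,-z₃)`. -/
def flip23 {q : ℕ} (z : Euc (3 + q)) : Euc (3 + q) :=
  epair (mk3 (zPrime z 0) (-(zPrime z 1)) (-(zPrime z 2))) (zSecond z)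

/-- Membership in the symmetric class `H_s` (inside `D^{1,2}`). -/
def memHs (m q k : ℕ) (u : Euc (m + (3 + q)) → ℝ) : Prop :=
  (Integrable fun x : Euc (m + (3 + q)) => ‖fderiv ℝ u x‖ ^ 2) ∧
  (Integrable fun x : Euc (m + (3 + q)) => |u x| ^ twoStar (m + (3 + q)) / ‖yPart x‖) ∧
  (∀ x x' : Euc (m + (3 + q)), ‖yPart x‖ = ‖yPart x'‖ → zPart x = zPart x' → u x = u x') ∧
  (∀ x : Euc (m + (3 + q)), u (epair (yPart x) (flip23 (zPart x))) = u x) ∧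
  (∀ x : Euc (m + (3 + q)), u (epair (yPart x) (rot2 (2 * π / k) (zPart x))) = u x)

/-- Membership in the constrained space `ℍ`. -/
def memH (m q k : ℕ) (η : Euc (m + (3 + q)) → ℝ) (r h : ℝ) (w : Euc q) (lam : ℝ)
    (v : Euc (m + (3 + q)) → ℝ) : Prop :=
  memHs m q k v ∧
  ∀ j ∈ Finset.Icc 1 k, ∀ l ∈ Finset.Icc 2 (3 + q), ∀ sgn ∈ ({1, -1} : Set ℝ),
    ∫ x : Euc (m + (3 + q)),
      (Zxi m q k η r h sgn w j lam x) ^ (twoStar (m + (3 + q)) - 2) / ‖yPart x‖ *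
        Zder m q k η r h sgn w j lam l x * v x = 0

/-- The right-hand side family `Σ_j (Z_{ξ_j^±,λ}^{2⋆-2}/|y|) Z_{j,l}^±`. -/
def orthFam (m q k : ℕ) (η : Euc (m + (3 + q)) → ℝ) (r h : ℝ) (w : Euc q) (lam : ℝ) (l : ℕ)
    (x : Euc (m + (3 + q))) : ℝ :=
  ∑ j ∈ Finset.Icc 1 k,
    ((Zxi m q k η r h 1 w j lam x) ^ (twoStar (m + (3 + q)) - 2) / ‖yPart x‖ *
        Zder m q k η r h 1 w j lam l x +
     (Zxi m q k η r h (-1) w j lam x) ^ (twoStar (m + (3 + q)) - 2) / ‖yPart x‖ *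
        Zder m q k η r h (-1) w j lam l x)

/-- `Σ_l c_l Σ_j (Z_{ξ_j^±,λ}^{2⋆-2}/|y|) Z_{j,l}^±`. -/
def multSum (m q k : ℕ) (η : Euc (m + (3 + q)) → ℝ) (r h : ℝ) (w : Euc q) (lam : ℝ)
    (c : ℕ → ℝ) (x : Euc (m + (3 + q))) : ℝ :=
  ∑ l ∈ Finset.Icc 2 (3 + q), c l * orthFam m q k η r h w lam l x

/-- The linearized problem (2.1). -/
def linEq (m q k : ℕ) (Vb Qb : ℝ × Euc q → ℝ) (η : Euc (m + (3 + q)) → ℝ) (r h : ℝ)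
    (w : Euc q) (lam : ℝ) (c : ℕ → ℝ) (f φ : Euc (m + (3 + q)) → ℝ) : Prop :=
  ∀ x, -lap φ x + potX m q Vb x * φ x -
      (twoStar (m + (3 + q)) - 1) * potX m q Qb x *
        ((Zfun m q k η r h w lam x) ^ (twoStar (m + (3 + q)) - 2) / ‖yPart x‖) * φ x
    = f x + multSum m q k η r h w lam c x

/-- The residual of `u = Z + φ` in the equation. -/
def resid (m q k : ℕ) (Vb Qb : ℝ × Euc q → ℝ) (η : Euc (m + (3 + q)) → ℝ) (r h : ℝ)
    (w : Euc q) (lam : ℝ) (φ : Euc (m + (3 + q)) → ℝ) (x : Euc (m + (3 + q))) : ℝ :=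
  -lap (fun x' => Zfun m q k η r h w lam x' + φ x') x
    + potX m q Vb x * (Zfun m q k η r h w lam x + φ x)
    - potX m q Qb x *
        (max (Zfun m q k η r h w lam x + φ x) 0) ^ (twoStar (m + (3 + q)) - 1) / ‖yPart x‖

/-- The perturbed problem (2.6). -/
def pertEq (m q k : ℕ) (Vb Qb : ℝ × Euc q → ℝ) (η : Euc (m + (3 + q)) → ℝ) (r h : ℝ)
    (w : Euc q) (lam : ℝ) (c : ℕ → ℝ) (φ : Euc (m + (3 + q)) → ℝ) : Prop :=
  ∀ x, resid m q k Vb Qb η r h w lam φ x = multSum m q k η r h w lam c x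

/-- Condition (C₁): boundedness and nonnegativity. -/
def CondC1 (q : ℕ) (Vb Qb : ℝ × Euc q → ℝ) : Prop :=
  (∃ C, ∀ a, |Vb a| ≤ C ∧ |Qb a| ≤ C) ∧ ∀ a, 0 ≤ Vb a ∧ 0 ≤ Qb a

/-- `a0` is a stable critical point of `Qb` (the meaning of `deg(∇Q, a0) ≠ 0`). -/
def StableCrit (q : ℕ) (Qb : ℝ × Euc q → ℝ) (a0 : ℝ × Euc q) (ρ : ℝ) : Prop :=
  fderiv ℝ Qb a0 = 0 ∧
  ∀ ρ', 0 < ρ' → ρ' ≤ ρ →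
    ∃ ε > 0, ∀ G : ℝ × Euc q → (ℝ × Euc q) →L[ℝ] ℝ,
      ContinuousOn G (closedBall a0 ρ') →
      (∀ a ∈ closedBall a0 ρ', ‖G a - fderiv ℝ Qb a‖ ≤ ε) →
      ∃ a ∈ closedBall a0 ρ', G a = 0

/-- Condition (C₂). -/
def CondC2 (q : ℕ) (Qb : ℝ × Euc q → ℝ) (r0 : ℝ) (z0 : Euc q) (ρ : ℝ) : Prop :=
  0 < r0 ∧ Qb (r0, z0) = 1 ∧ StableCrit q Qb (r0, z0) ρ

/-- The Laplacian of a function of `(r, z'')`. -/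
def lapRZ (q : ℕ) (Qb : ℝ × Euc q → ℝ) (a : ℝ × Euc q) : ℝ :=
  iteratedDeriv 2 (fun t => Qb (t, a.2)) a.1 +
    ∑ i : Fin q, iteratedDeriv 2 (fun t => Qb (a.1, updE a.2 i t)) (a.2 i)

/-- Condition (C₃); `Bt` is the constant `B̃₁`. -/
def CondC3 (m q : ℕ) (Vb Qb : ℝ × Euc q → ℝ) (r0 : ℝ) (z0 : Euc q) (ρ Bt : ℝ) : Prop :=
  0 < ρ ∧ ContDiffOn ℝ 1 Vb (ball (r0, z0) ρ) ∧ ContDiffOn ℝ 3 Qb (ball (r0, z0) ρ) ∧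
  0 < Bt ∧
  (∀ (ξ : Euc (3 + q)) (lam : ℝ), 0 < lam →
    deriv (fun t => ∫ x : Euc (m + (3 + q)), (Ubub m (3 + q) ξ t x) ^ 2) lam
      = -(2 * Bt) / lam ^ 3) ∧
  0 < Bt * Vb (r0, z0) * (∫ x : Euc (m + (3 + q)), (Ubub m (3 + q) 0 1 x) ^ 2) -
      lapRZ q Qb (r0, z0) / (twoStar (m + (3 + q)) * ((3 : ℝ) + q)) *
        ∫ x : Euc (m + (3 + q)),
          ‖zPart x‖ ^ 2 / ‖yPart x‖ * (Ubub m (3 + q) 0 1 x) ^ twoStar (m + (3 + q))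

/-- The constant `B₁` of the energy expansion. -/
def B1const (m q : ℕ) (Vb Qb : ℝ × Euc q → ℝ) (r0 : ℝ) (z0 : Euc q) (Bt : ℝ) : ℝ :=
  Bt * Vb (r0, z0) * (∫ x : Euc (m + (3 + q)), (Ubub m (3 + q) 0 1 x) ^ 2) -
    lapRZ q Qb (r0, z0) / (twoStar (m + (3 + q)) * ((3 : ℝ) + q)) *
      ∫ x : Euc (m + (3 + q)),
        ‖zPart x‖ ^ 2 / ‖yPart x‖ * (Ubub m (3 + q) 0 1 x) ^ twoStar (m + (3 + q))

/-- The energy functional `I`. -/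
def Ifun (m q : ℕ) (Vb Qb : ℝ × Euc q → ℝ) (u : Euc (m + (3 + q)) → ℝ) : ℝ :=
  (1 / 2) * (∫ x : Euc (m + (3 + q)), (‖fderiv ℝ u x‖ ^ 2 + potX m q Vb x * u x ^ 2)) -
  (1 / twoStar (m + (3 + q))) *
    ∫ x : Euc (m + (3 + q)),
      potX m q Qb x * (max (u x) 0) ^ twoStar (m + (3 + q)) / ‖yPart x‖

/-- `β₁ = α/(N-2)` where `α = N - 4 - ι`. -/
def beta1 (m q : ℕ) (ι : ℝ) : ℝ :=
  (((m + (3 + q) : ℕ) : ℝ) - 4 - ι) / (((m + (3 + q) : ℕ) : ℝ) - 2)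

/-- `τ = (N-4-α)/(N-2-α) = ι/(2+ι)` in the Case 1 regime. -/
def tau1 (ι : ℝ) : ℝ := ι / (2 + ι)

/-- The Case-1 parameter regime for a single `k` (with slack `θ` in the `o(·)` condition). -/
def regime1 (m q : ℕ) (r0 : ℝ) (z0 : Euc q) (ι L0 L1 M1 ϑ θ : ℝ) (k : ℕ)
    (lam r h : ℝ) (w : Euc q) : Prop :=
  (L0 * (k : ℝ) ^ (((((m + (3 + q) : ℕ) : ℝ)) - 2) / ι) ≤ lam ∧
     lam ≤ L1 * (k : ℝ) ^ (((((m + (3 + q) : ℕ) : ℝ)) - 2) / ι)) ∧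
  0 < r ∧ 0 < h ∧ h < 1 ∧
  distRZ q r w r0 z0 ≤ lam ^ (-(1 - ϑ)) ∧
  |Real.sqrt (1 - h ^ 2) - M1 * lam ^ (-(beta1 m q ι))| ≤ θ * lam ^ (-(beta1 m q ι))

/-- `∂Z_{r̄,h̄,z̄'',λ}/∂λ`. -/
def dZlam (m q k : ℕ) (η : Euc (m + (3 + q)) → ℝ) (r h : ℝ) (w : Euc q) (lam : ℝ)
    (x : Euc (m + (3 + q))) : ℝ :=
  deriv (fun t => Zfun m q k η r h w t x) lam

/-- The coordinate direction of `z''_i` inside `ℝ^N`. -/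
def dirZ'' (m q : ℕ) (i : Fin q) : Euc (m + (3 + q)) :=
  epair (0 : Euc m) (epair (0 : Euc 3) (EuclideanSpace.single i (1 : ℝ)))

/-- `N` as a real number. -/
def Nreal (m q : ℕ) : ℝ := ((m + (3 + q) : ℕ) : ℝ)

/-- The radial profile `(R + s)^{-A} s^{-c}`. -/
def powKer (R A c s : ℝ) : ℝ := (R + s) ^ (-A) * s ^ (-c)

lemma powKer_nonneg {R s : ℝ} (hR : 0 ≤ R) (hs : 0 ≤ s) (A c : ℝ) : 0 ≤ powKer R A c s :=
  mul_nonneg (rpow_nonneg (by positivity) _) (rpow_nonneg hs _)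

lemma measurable_powKer (R A c : ℝ) : Measurable (powKer R A c) := by
  unfold powKer
  fun_prop

lemma powKer_mul {R s : ℝ} (hR : 0 < R) (hs : 0 ≤ s) (A c : ℝ) :
    powKer R A c (R * s) = R ^ (-A - c) * powKer 1 A c s := by
  unfold powKer
  rw [show R + R * s = R * (1 + s) by ring, mul_rpow hR.le (by positivity), mul_rpow hR.le hs,
    show -A - c = -A + -c by ring, rpow_add hR]
  ring

lemma integrable_powKer_norm {d : ℕ} (hd : 0 < d) {A c R : ℝ} (hR : 0 < R) (hc : c < d)
    (hAc : d < A + c) :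
    Integrable (fun y : Euc d => powKer R A c ‖y‖) := by
  have : Nonempty (Fin d) := ⟨⟨0, hd⟩⟩
  have hpow : ∀ y : ℝ, 0 < y → y ^ (d - 1) = y ^ ((d : ℝ) - 1) := fun y _ => by
    rw [← rpow_natCast, Nat.cast_sub hd, Nat.cast_one]
  have hmeas : Measurable fun y : ℝ => y ^ (d - 1) • powKer R A c y :=
    (measurable_id.pow_const _).smul (measurable_powKer R A c)
  rw [integrable_fun_norm_addHaar volume, finrank_euclideanSpace_fin,
    ← Set.Ioc_union_Ioi_eq_Ioi zero_le_one]
  refine IntegrableOn.union ?_ ?_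
  · have h1 : IntegrableOn (fun y : ℝ => R ^ (-A) * y ^ ((d : ℝ) - 1 - c)) (Set.Ioc 0 1) := by
      refine Integrable.const_mul ?_ _
      exact (intervalIntegrable_iff_integrableOn_Ioc_of_le zero_le_one).1
        (intervalIntegral.intervalIntegrable_rpow' (by linarith))
    refine h1.mono' hmeas.aestronglyMeasurable ?_
    filter_upwards [ae_restrict_mem measurableSet_Ioc] with y hy
    have hy0 : 0 < y := hy.1
    rw [norm_of_nonneg (smul_nonneg (by positivity) (powKer_nonneg hR.le hy0.le A c)), smul_eq_mul,
      hpow y hy0, powKer, sub_eq_add_neg _ c, rpow_add hy0, mul_left_comm]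
    gcongr ?_ * _
    exact rpow_le_rpow_of_nonpos hR (by linarith) (by linarith)
  · have h1 : IntegrableOn (fun y : ℝ => y ^ ((d : ℝ) - 1 - c - A)) (Set.Ioi 1) :=
      integrableOn_Ioi_rpow_of_lt (by linarith) zero_lt_one
    refine h1.mono' hmeas.aestronglyMeasurable ?_
    filter_upwards [ae_restrict_mem measurableSet_Ioi] with y hy
    have hy0 : 0 < y := zero_lt_one.trans hy
    rw [norm_of_nonneg (smul_nonneg (by positivity) (powKer_nonneg hR.le hy0.le A c)), smul_eq_mul,
      hpow y hy0, powKer, sub_eq_add_neg _ A, sub_eq_add_neg _ c, rpow_add hy0, rpow_add hy0,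
      mul_left_comm, mul_comm]
    gcongr _ * ?_
    exact rpow_le_rpow_of_nonpos hy0 (by linarith) (by linarith)

lemma integral_powKer_norm (d : ℕ) (A c : ℝ) {R : ℝ} (hR : 0 < R) :
    ∫ y : Euc d, powKer R A c ‖y‖ = R ^ (d - A - c) * ∫ y : Euc d, powKer 1 A c ‖y‖ := by
  have h := Measure.integral_comp_smul_of_nonneg volume
    (fun y : Euc d => powKer R A c ‖y‖) R (hR := hR.le)
  simp only [norm_smul, norm_of_nonneg hR.le, powKer_mul hR (norm_nonneg _), smul_eq_mul,
    finrank_euclideanSpace_fin, integral_const_mul] at h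
  rw [show (d : ℝ) - A - c = d + (-A - c) by ring, rpow_add hR, rpow_natCast, mul_assoc, h,
    mul_inv_cancel_left₀ (by positivity)]

lemma measurePreserving_yPart_zPart (m p : ℕ) :
    MeasurePreserving (fun x : Euc (m + p) => (yPart x, zPart x)) := by
  have h1 := EuclideanSpace.volume_preserving_symm_measurableEquiv_toLp (Fin (m + p))
  have h2 := volume_measurePreserving_piCongrLeft (fun _ : Fin m ⊕ Fin p => ℝ)
    (finSumFinEquiv (m := m) (n := p)).symm
  have h3 := volume_measurePreserving_sumPiEquivProdPi (fun _ : Fin m ⊕ Fin p => ℝ)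
  have h4 := (EuclideanSpace.volume_preserving_symm_measurableEquiv_toLp (Fin m)).symm.prod
    (EuclideanSpace.volume_preserving_symm_measurableEquiv_toLp (Fin p)).symm
  have h := h4.comp (h3.comp (h2.comp h1))
  have heq : ∀ x : Fin (m + p) → ℝ, ∀ i : Fin m ⊕ Fin p,
      MeasurableEquiv.piCongrLeft (fun _ : Fin m ⊕ Fin p => ℝ) finSumFinEquiv.symm x i =
        x (finSumFinEquiv i) := fun x i => by
    simpa using MeasurableEquiv.piCongrLeft_apply_apply (β := fun _ : Fin m ⊕ Fin p => ℝ)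
      finSumFinEquiv.symm x (finSumFinEquiv i)
  convert! h using 1
  funext x
  refine Prod.ext (PiLp.ext fun i => ?_) (PiLp.ext fun i => ?_)
  · exact (heq (WithLp.ofLp x) (Sum.inl i)).symm
  · exact (heq (WithLp.ofLp x) (Sum.inr i)).symm

lemma norm_sq_eq_yPart_add_zPart {m p : ℕ} (x : Euc (m + p)) :
    ‖x‖ ^ 2 = ‖yPart x‖ ^ 2 + ‖zPart x‖ ^ 2 := by
  simp [EuclideanSpace.norm_sq_eq, Fin.sum_univ_add, yPart, zPart]

lemma norm_yPart_le {m p : ℕ} (x : Euc (m + p)) : ‖yPart x‖ ≤ ‖x‖ :=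
  le_of_sq_le_sq (by nlinarith [norm_sq_eq_yPart_add_zPart x, sq_nonneg ‖zPart x‖]) (norm_nonneg x)

lemma norm_zPart_le {m p : ℕ} (x : Euc (m + p)) : ‖zPart x‖ ≤ ‖x‖ :=
  le_of_sq_le_sq (by nlinarith [norm_sq_eq_yPart_add_zPart x, sq_nonneg ‖yPart x‖]) (norm_nonneg x)

lemma yPart_sub {m p : ℕ} (x x' : Euc (m + p)) : yPart (x - x') = yPart x - yPart x' := rfl

lemma zPart_sub {m p : ℕ} (x x' : Euc (m + p)) : zPart (x - x') = zPart x - zPart x' := rfl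

lemma integrable_yPart_mul_zPart {m p : ℕ} {f : Euc m → ℝ} {g : Euc p → ℝ}
    (hf : Integrable f) (hg : Integrable g) :
    Integrable fun x : Euc (m + p) => f (yPart x) * g (zPart x) :=
  (measurePreserving_yPart_zPart m p).integrable_comp_of_integrable (hf.mul_prod hg)

lemma integral_yPart_mul_zPart {m p : ℕ} {f : Euc m → ℝ} {g : Euc p → ℝ}
    (hf : Integrable f) (hg : Integrable g) :
    ∫ x : Euc (m + p), f (yPart x) * g (zPart x) = (∫ y, f y) * ∫ z, g z := by
  have h := measurePreserving_yPart_zPart m p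
  have hfg := (hf.mul_prod hg).aestronglyMeasurable
  rw [← integral_prod_mul f g, ← Measure.volume_eq_prod, ← h.map_eq, integral_map h.aemeasurable]
  rw [h.map_eq]
  exact hfg

lemma ae_yPart_ne {m p : ℕ} (hm : 0 < m) (a : Euc m) : ∀ᵐ x : Euc (m + p), yPart x ≠ a := by
  have : Nonempty (Fin m) := ⟨⟨0, hm⟩⟩
  exact (Measure.quasiMeasurePreserving_fst.comp
    (measurePreserving_yPart_zPart m p).quasiMeasurePreserving).ae (Measure.ae_ne volume a)

lemma ae_zPart_ne {m p : ℕ} (hp : 0 < p) (a : Euc p) : ∀ᵐ x : Euc (m + p), zPart x ≠ a := by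
  have : Nonempty (Fin p) := ⟨⟨0, hp⟩⟩
  exact (Measure.quasiMeasurePreserving_snd.comp
    (measurePreserving_yPart_zPart m p).quasiMeasurePreserving).ae (Measure.ae_ne volume a)

lemma powKer_add_exponent_le {R s t A c : ℝ} (hR : 0 < R) (hs : 0 < s) (ht : 0 < t) (hA : 0 ≤ A)
    (hc : 0 ≤ c) : powKer R A c s * t⁻¹ ≤ powKer R A (c + 1) s + powKer R A (c + 1) t := by
  have key : ∀ u : ℝ, 0 < u → powKer R A (c + 1) u = powKer R A c u * u⁻¹ := fun u hu => by
    rw [powKer, powKer, neg_add, rpow_add hu, rpow_neg_one, mul_assoc]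
  rw [key s hs, key t ht]
  have hs' := powKer_nonneg hR.le hs.le A c
  have ht' := powKer_nonneg hR.le ht.le A c
  rcases le_total s t with h | h
  · have : powKer R A c s * t⁻¹ ≤ powKer R A c s * s⁻¹ := by gcongr
    have : 0 ≤ powKer R A c t * t⁻¹ := by positivity
    linarith
  · have : powKer R A c s ≤ powKer R A c t := by
      unfold powKer
      gcongr ?_ * ?_
      · exact rpow_le_rpow_of_nonpos (by positivity) (by linarith) (by linarith)
      · exact rpow_le_rpow_of_nonpos ht h (by linarith)
    have : powKer R A c s * t⁻¹ ≤ powKer R A c t * t⁻¹ := by gcongr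
    have : 0 ≤ powKer R A c s * s⁻¹ := by positivity
    linarith

lemma kernel_le_near {R r s t u w n α β σ : ℝ} (hs : 0 < s) (ht : 0 < t) (hsr : s ≤ r)
    (htr : t ≤ r) (hu : 0 < u) (hw : R ≤ w + 2 * r) (hr : 4 * r ≤ R) (hα : 0 ≤ α) (hβ : 0 ≤ β)
    (hσ : 0 < σ) (hn : n = α + β) :
    r ^ (-n) * (1 / (u * w ^ (1 + σ))) ≤
      4 * 2 ^ (1 + σ) * R ^ (1 - σ) * (powKer R 1 α s * u⁻¹ * powKer R 1 β t) := by
  have hr0 : 0 < r := hs.trans_le hsr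
  have hR : 0 < R := by linarith
  have h1 : r ^ (-n) ≤ s ^ (-α) * t ^ (-β) := by
    rw [hn, neg_add, rpow_add hr0]
    gcongr ?_ * ?_
    · exact rpow_le_rpow_of_nonpos hs hsr (by linarith)
    · exact rpow_le_rpow_of_nonpos ht htr (by linarith)
  have h2 : w ^ (-(1 + σ)) ≤ (R / 2) ^ (-(1 + σ)) :=
    rpow_le_rpow_of_nonpos (by positivity) (by linarith) (by linarith)
  have h3 : (R / 2) ^ (-(1 + σ)) = 4 * 2 ^ (1 + σ) * R ^ (1 - σ) * ((2 * R)⁻¹ * (2 * R)⁻¹) := by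
    rw [div_rpow hR.le zero_le_two, rpow_neg zero_le_two, show 1 - σ = -(1 + σ) + 2 by ring,
      rpow_add hR, rpow_two]
    field_simp
    norm_num
  have hinv : ∀ q : ℝ, 0 < q → q ≤ r → (2 * R)⁻¹ ≤ (R + q) ^ (-1 : ℝ) := fun q hq hqr => by
    rw [rpow_neg_one]
    exact inv_anti₀ (by positivity) (by linarith)
  have hw0 : 0 < w := by linarith
  calc r ^ (-n) * (1 / (u * w ^ (1 + σ))) = r ^ (-n) * (u⁻¹ * w ^ (-(1 + σ))) := by
        rw [rpow_neg hw0.le, one_div, mul_inv]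
    _ ≤ s ^ (-α) * t ^ (-β) *
        (u⁻¹ * (4 * 2 ^ (1 + σ) * R ^ (1 - σ) * ((2 * R)⁻¹ * (2 * R)⁻¹))) := by
        rw [← h3]
        gcongr
    _ ≤ s ^ (-α) * t ^ (-β) * (u⁻¹ * (4 * 2 ^ (1 + σ) * R ^ (1 - σ) *
        ((R + s) ^ (-1 : ℝ) * (R + t) ^ (-1 : ℝ)))) := by
        gcongr
        · exact hinv s hs hsr
        · exact hinv t ht htr
    _ = _ := by
        unfold powKer
        ring

lemma kernel_le_far {R r u v w n A B a b σ : ℝ} (hR : 0 < R) (hu : 0 < u) (hv : 0 < v)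
    (huw : u ≤ w) (hvw : v ≤ w) (hw : w ≤ R + 2 * r) (hr : R ≤ 4 * r) (hA : 0 ≤ A) (hB : 0 ≤ B)
    (ha : 0 ≤ a) (hb : 0 ≤ b) (hn : n = A + B) (hσ : 1 + σ = a + b) :
    r ^ (-n) * (1 / (u * w ^ (1 + σ))) ≤ 10 ^ n * (powKer R A (a + 1) u * powKer R B b v) := by
  have hr0 : 0 < r := by linarith
  have hw0 : 0 < w := by linarith
  have h1 : r ^ (-n) ≤ 10 ^ n * ((R + u) ^ (-A) * (R + v) ^ (-B)) := by
    have h : r ^ (-n) = 10 ^ n * (10 * r) ^ (-n) := by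
      rw [mul_rpow (by norm_num) hr0.le, rpow_neg (by norm_num : (0 : ℝ) ≤ 10),
        mul_inv_cancel_left₀ (by positivity)]
    rw [h]
    nth_rewrite 2 [hn]
    rw [neg_add, rpow_add (by positivity)]
    gcongr ?_ * (?_ * ?_)
    · exact rpow_le_rpow_of_nonpos (by positivity) (by linarith) (by linarith)
    · exact rpow_le_rpow_of_nonpos (by positivity) (by linarith) (by linarith)
  have h2 : w ^ (-(1 + σ)) ≤ u ^ (-a) * v ^ (-b) := by
    rw [hσ, neg_add, rpow_add hw0]
    gcongr ?_ * ?_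
    · exact rpow_le_rpow_of_nonpos hu huw (by linarith)
    · exact rpow_le_rpow_of_nonpos hv hvw (by linarith)
  calc r ^ (-n) * (1 / (u * w ^ (1 + σ))) = r ^ (-n) * (u⁻¹ * w ^ (-(1 + σ))) := by
        rw [rpow_neg hw0.le, one_div, mul_inv]
    _ ≤ 10 ^ n * ((R + u) ^ (-A) * (R + v) ^ (-B)) * (u⁻¹ * (u ^ (-a) * v ^ (-b))) := by
        gcongr
    _ = _ := by
        rw [powKer, powKer, neg_add a, rpow_add hu, rpow_neg_one]
        ring

lemma integral_kernel_le {m p : ℕ} (hm : 0 < m) (hp : 0 < p) {n σ α β A B a b : ℝ} (hσ : 0 < σ)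
    (hn : n = α + β) (hα : 0 ≤ α) (hα₁ : α + 1 < m) (hα₂ : m < 1 + (α + 1))
    (hβ : 0 ≤ β) (hβ₁ : β < p) (hβ₂ : p < 1 + β) (hnN : n = m + p - 2)
    (hnAB : n = A + B) (hσab : 1 + σ = a + b) (hA : 0 ≤ A) (hB : 0 ≤ B) (ha : 0 ≤ a) (hb : 0 ≤ b)
    (ha₁ : a + 1 < m) (ha₂ : m < A + (a + 1)) (hb₁ : b < p) (hb₂ : p < B + b) :
    ∃ C > (0 : ℝ), ∀ (ξ : Euc p) (x : Euc (m + p)),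
      (∫ xt : Euc (m + p), ‖x - xt‖ ^ (-n) *
        (1 / (‖yPart xt‖ * (1 + ‖yPart xt‖ + ‖zPart xt - ξ‖) ^ (1 + σ)))) ≤
        C * (1 + ‖yPart x‖ + ‖zPart x - ξ‖) ^ (-σ) := by
  have hI : ∀ (d : ℕ) (A c : ℝ), 0 ≤ ∫ y : Euc d, powKer 1 A c ‖y‖ := fun d A c =>
    integral_nonneg fun y => powKer_nonneg zero_le_one (norm_nonneg y) A c
  set K₁ := ∫ y : Euc m, powKer 1 1 (α + 1) ‖y‖
  set K₂ := ∫ z : Euc p, powKer 1 1 β ‖z‖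
  set K₃ := ∫ y : Euc m, powKer 1 A (a + 1) ‖y‖
  set K₄ := ∫ z : Euc p, powKer 1 B b ‖z‖
  have hK₁ : 0 ≤ K₁ := hI _ _ _
  have hK₂ : 0 ≤ K₂ := hI _ _ _
  have hK₃ : 0 ≤ K₃ := hI _ _ _
  have hK₄ : 0 ≤ K₄ := hI _ _ _
  refine ⟨4 * 2 ^ (1 + σ) * (2 * K₁ * K₂) + 10 ^ n * (K₃ * K₄) + 1, by positivity, fun ξ x => ?_⟩
  set R := 1 + ‖yPart x‖ + ‖zPart x - ξ‖ with hRdef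
  have hR : 0 < R := by positivity
  have hP := integrable_powKer_norm hm hR hα₁ hα₂
  have hP' := hP.comp_sub_left (yPart x)
  have hS := (integrable_powKer_norm hp hR hβ₁ hβ₂).comp_sub_left (zPart x)
  have hT := integrable_powKer_norm hm hR ha₁ ha₂
  have hU := (integrable_powKer_norm hp hR hb₁ hb₂).comp_sub_right ξ
  have hnear := (integrable_yPart_mul_zPart (hP'.add hP) hS).const_mul
    (4 * 2 ^ (1 + σ) * R ^ (1 - σ))
  have hfar := (integrable_yPart_mul_zPart hT hU).const_mul (10 ^ n)
  have hbound := integral_mono_of_nonneg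
    (f := fun xt : Euc (m + p) => ‖x - xt‖ ^ (-n) *
      (1 / (‖yPart xt‖ * (1 + ‖yPart xt‖ + ‖zPart xt - ξ‖) ^ (1 + σ))))
    (.of_forall fun xt => by positivity) (hnear.add hfar) (by
      filter_upwards [ae_yPart_ne hm (yPart x), ae_yPart_ne hm 0, ae_zPart_ne hp (zPart x),
        ae_zPart_ne hp ξ] with xt h1 h2 h3 h4
      have hs : 0 < ‖yPart x - yPart xt‖ := norm_pos_iff.2 (sub_ne_zero.2 h1.symm)
      have ht : 0 < ‖zPart x - zPart xt‖ := norm_pos_iff.2 (sub_ne_zero.2 h3.symm)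
      have hu : 0 < ‖yPart xt‖ := norm_pos_iff.2 h2
      have hv : 0 < ‖zPart xt - ξ‖ := norm_pos_iff.2 (sub_ne_zero.2 h4)
      have hsr : ‖yPart x - yPart xt‖ ≤ ‖x - xt‖ := norm_yPart_le (x - xt)
      have htr : ‖zPart x - zPart xt‖ ≤ ‖x - xt‖ := norm_zPart_le (x - xt)
      have e1 : ‖yPart x‖ ≤ ‖yPart x - yPart xt‖ + ‖yPart xt‖ := norm_le_norm_sub_add _ _
      have e2 : ‖yPart xt‖ ≤ ‖yPart x - yPart xt‖ + ‖yPart x‖ := by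
        rw [norm_sub_rev]
        exact norm_le_norm_sub_add _ _
      have e3 : ‖zPart x - ξ‖ ≤ ‖zPart x - zPart xt‖ + ‖zPart xt - ξ‖ :=
        norm_sub_le_norm_sub_add_norm_sub _ _ _
      have e4 : ‖zPart xt - ξ‖ ≤ ‖zPart x - zPart xt‖ + ‖zPart x - ξ‖ := by
        rw [norm_sub_rev (zPart x) (zPart xt)]
        exact norm_sub_le_norm_sub_add_norm_sub _ _ _
      have hk := fun {q : ℝ} (hq : 0 < q) (A c : ℝ) => powKer_nonneg hR.le hq.le A c
      simp only [Pi.add_apply]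
      rcases le_total (4 * ‖x - xt‖) R with h | h
      · refine (kernel_le_near hs ht hsr htr hu (by linarith) h hα hβ hσ hn).trans
          (le_add_of_le_of_nonneg ?_ ?_)
        · gcongr ?_ * (?_ * ?_)
          · exact hk ht _ _
          · exact powKer_add_exponent_le hR hs hu zero_le_one hα
        · have := hk hu A (a + 1)
          have := hk hv B b
          positivity
      · refine (kernel_le_far hR hu hv (by linarith) (by linarith) (by linarith) h hA hB ha hb
          hnAB hσab).trans (le_add_of_nonneg_left ?_)
        have := hk hs 1 (α + 1)
        have := hk hu 1 (α + 1)
        have := hk ht 1 β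
        positivity)
  refine hbound.trans ?_
  rw [integral_add' hnear hfar, integral_const_mul, integral_const_mul,
    integral_yPart_mul_zPart (hP'.add hP) hS, integral_yPart_mul_zPart hT hU,
    integral_add' hP' hP,
    integral_sub_left_eq_self (fun y : Euc m => powKer R 1 (α + 1) ‖y‖) volume (yPart x),
    integral_sub_left_eq_self (fun z : Euc p => powKer R 1 β ‖z‖) volume (zPart x),
    integral_sub_right_eq_self (fun z : Euc p => powKer R B b ‖z‖) ξ,
    integral_powKer_norm m 1 (α + 1) hR, integral_powKer_norm p 1 β hR,
    integral_powKer_norm m A (a + 1) hR, integral_powKer_norm p B b hR]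
  have p1 : R ^ (1 - σ) * (R ^ (m - 1 - (α + 1)) * R ^ (p - 1 - β)) = R ^ (-σ) := by
    rw [← rpow_add hR, ← rpow_add hR]
    congr 1
    linarith
  have p2 : R ^ (m - A - (a + 1)) * R ^ (p - B - b) = R ^ (-σ) := by
    rw [← rpow_add hR]
    congr 1
    linarith
  calc _ = 4 * 2 ^ (1 + σ) * (2 * K₁ * K₂) *
          (R ^ (1 - σ) * (R ^ (m - 1 - (α + 1)) * R ^ (p - 1 - β))) +
        10 ^ n * (K₃ * K₄) * (R ^ (m - A - (a + 1)) * R ^ (p - B - b)) := by ring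
    _ ≤ _ := by
        rw [p1, p2, ← add_mul]
        exact mul_le_mul_of_nonneg_right (le_add_of_nonneg_right zero_le_one) (rpow_nonneg hR.le _)

/-- Lemma A.2: the singular convolution estimate. -/
theorem stmt16 (m p : ℕ) (hN : 7 ≤ m + p) (hm1 : m + p + 1 ≤ 2 * m) (hm2 : m + 1 < m + p)
    (σ : ℝ) (hσ0 : 0 < σ) (hσ : σ < ((m + p : ℕ) : ℝ) - 2) :
    ∃ C > (0 : ℝ), ∀ (ξ : Euc p) (x : Euc (m + p)),
      (∫ xt : Euc (m + p),
          ‖x - xt‖ ^ (-(((m + p : ℕ) : ℝ) - 2)) *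
            (1 / (‖yPart xt‖ * (1 + ‖yPart xt‖ + ‖zPart xt - ξ‖) ^ (1 + σ)))) ≤
        C * (1 + ‖yPart x‖ + ‖zPart x - ξ‖) ^ (-σ) := by
  have hN' : (7 : ℝ) ≤ m + p := by exact_mod_cast hN
  have hm1' : (m : ℝ) + p + 1 ≤ 2 * m := by exact_mod_cast hm1
  have hp' : (2 : ℝ) ≤ p := by
    have : 2 ≤ p := by omega
    exact_mod_cast this
  push_cast at hσ ⊢
  have hNpos : (0 : ℝ) < m + p := by linarith
  refine integral_kernel_le (by omega) (by omega) (α := m - 3 / 2) (β := p - 1 / 2)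
    (A := m * (m + p - 2) / (m + p)) (B := p * (m + p - 2) / (m + p))
    (a := m * (2 + σ) / (m + p) - 1) (b := p * (2 + σ) / (m + p)) hσ0
    (by ring) (by linarith) (by linarith) (by linarith) (by linarith) (by linarith) (by linarith)
    rfl (by field_simp) (by field_simp; ring)
    (div_nonneg (mul_nonneg (by linarith) (by linarith)) hNpos.le)
    (div_nonneg (mul_nonneg (by linarith) (by linarith)) hNpos.le)
    ?_ (by positivity) ?_ ?_ ?_ ?_
  · rw [sub_nonneg, one_le_div hNpos]
    nlinarith
  · rw [sub_add_cancel, div_lt_iff₀ hNpos]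
    nlinarith
  · rw [sub_add_cancel, ← add_div, lt_div_iff₀ hNpos]
    nlinarith
  · rw [div_lt_iff₀ hNpos]
    nlinarith
  · rw [← add_div, lt_div_iff₀ hNpos]
    nlinarith
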